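/- Example 1 verification: Let M' be the causal model with one exogenous binary variable C, endogenous binary variables A and B with equations A = C and B = C, and endogenous variable E with range {0,1,2} and equation E = A + B. Then (i) C is an ancestor of E in M'; (ii) there is no directed path p in M' such that (1_C,0_C) ⤳_p (2_E,0_E), i.e., no chain of single-variable potential-parenthood steps links C's values 1,0 to E's values 2,0; but (iii) (1_C,0_C) are potential joint ancestors of (2_E,0_E) in M', via (1_C,0_C) ⤳ (1_A,1_B; 0_A,0_B) ⤳ (2_E,0_E). -/

import Mathlib

set_option linter.unusedVariables false

attribute [local instance] Classical.propDecidable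

/-- A causal model `M = ((U,V,R),F)` with exogenous variables `U`, endogenous
variables `V`, ranges `RU u` / `RV v`, and for each endogenous variable a
structural equation giving its value in terms of the values of all the other
variables (the equation may not depend on the variable's own value). -/
structure CausalModel (U V : Type) (RU : U → Type) (RV : V → Type) where
  F : ∀ X : V, (∀ u, RU u) → (∀ v, RV v) → RV X
  selfIndep : ∀ (X : V) (ctx : ∀ u, RU u) (a a' : ∀ v, RV v),
    (∀ Y : V, Y ≠ X → a Y = a' Y) → F X ctx a = F X ctx a'

namespace CausalModel

variable {U V : Type} {RU : U → Type} {RV : V → Type}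

/-- `Y` depends on the endogenous variable `X`: for some context and some setting
of the endogenous variables, varying the value of `X` changes the value of `F Y`.
(`X` is then an (endogenous) parent of `Y`.) -/
def DependsOnE (M : CausalModel U V RU RV) (Y X : V) : Prop :=
  X ≠ Y ∧ ∃ (ctx : ∀ u, RU u) (a : ∀ v, RV v) (x x' : RV X),
    M.F Y ctx (Function.update a X x) ≠ M.F Y ctx (Function.update a X x')

/-- `Y` depends on the exogenous variable `X`. -/
def DependsOnX (M : CausalModel U V RU RV) (Y : V) (X : U) : Prop :=
  ∃ (ctx : ∀ u, RU u) (a : ∀ v, RV v) (x x' : RU X),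
    M.F Y (Function.update ctx X x) a ≠ M.F Y (Function.update ctx X x') a

/-- `M` is strongly recursive: there is a (strict) partial order on the
endogenous variables such that whenever `Y` depends on `X`, `X` strictly
precedes `Y`. -/
def StronglyRecursive (M : CausalModel U V RU RV) : Prop :=
  ∃ lt : V → V → Prop, IsStrictOrder V lt ∧ ∀ Y X : V, M.DependsOnE Y X → lt X Y

/-- `a` simultaneously satisfies all structural equations of `M` in context `ctx`. -/
def Solves (M : CausalModel U V RU RV) (ctx : ∀ u, RU u) (a : ∀ v, RV v) : Prop :=
  ∀ X : V, a X = M.F X ctx a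

/-- `(M,ctx) ⊨ P`: `P` holds of the solution of the equations of `M` in context `ctx`. -/
def Sat (M : CausalModel U V RU RV) (ctx : ∀ u, RU u) (P : (∀ v, RV v) → Prop) : Prop :=
  ∀ a, M.Solves ctx a → P a

/-- The intervened model `M_{S ← b}`: the equation of each variable in `S` is
replaced by the constant value given by `b`; other equations are unchanged. -/
noncomputable def intervene (M : CausalModel U V RU RV) (S : Set V) (b : ∀ v, RV v) :
    CausalModel U V RU RV where
  F X ctx a := if X ∈ S then b X else M.F X ctx a
  selfIndep := by
    intro X ctx a a' h
    by_cases hX : X ∈ S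
    · simp [hX]
    · simpa [hX] using M.selfIndep X ctx a a' h

/-- `X` is a parent of `Y` (both endogenous). -/
def ParentE (M : CausalModel U V RU RV) (X Y : V) : Prop := M.DependsOnE Y X

/-- `X` is an ancestor of `Y` (both endogenous): transitive closure of parenthood. -/
def AncestorE (M : CausalModel U V RU RV) : V → V → Prop :=
  Relation.TransGen fun X Y => M.DependsOnE Y X

/-- The exogenous variable `X` is an ancestor of the endogenous variable `Y`. -/
def AncestorX (M : CausalModel U V RU RV) (X : U) (Y : V) : Prop :=
  ∃ Z : V, M.DependsOnX Z X ∧ (Z = Y ∨ M.AncestorE Z Y)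

/-- `(x,x') ⤳ (y,y')` with witness `(ctx, z)`:
`F_Y(x,z,ctx) = y` and `F_Y(x',z,ctx) = y'`. -/
def LeadsToWith (M : CausalModel U V RU RV) (X : V) (x x' : RV X) (Y : V) (y y' : RV Y)
    (ctx : ∀ u, RU u) (z : ∀ v, RV v) : Prop :=
  M.F Y ctx (Function.update z X x) = y ∧ M.F Y ctx (Function.update z X x') = y'

/-- `x` rather than `x'` is a potential parent of `y` rather than `y'`
(single endogenous variables). -/
def PotParentEE (M : CausalModel U V RU RV) (X : V) (x x' : RV X) (Y : V) (y y' : RV Y) :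
    Prop :=
  X ≠ Y ∧ x ≠ x' ∧ y ≠ y' ∧ ∃ ctx z, M.LeadsToWith X x x' Y y y' ctx z

/-- `x` rather than `x'` (values of an exogenous variable `X`) is a potential
parent of `y` rather than `y'`. -/
def PotParentXE (M : CausalModel U V RU RV) (X : U) (x x' : RU X) (Y : V) (y y' : RV Y) :
    Prop :=
  x ≠ x' ∧ y ≠ y' ∧ ∃ (ctx : ∀ u, RU u) (z : ∀ v, RV v),
    M.F Y (Function.update ctx X x) z = y ∧ M.F Y (Function.update ctx X x') z = y'

/-- `(x,x') ⤳_p (y,y')` for some directed path `p` starting at the exogenous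
variable `X`: a chain of single-variable potential-parenthood steps. -/
inductive PotAncX (M : CausalModel U V RU RV) (X : U) (x x' : RU X) :
    ∀ Y : V, RV Y → RV Y → Prop
  | base {Y : V} {y y' : RV Y} : M.PotParentXE X x x' Y y y' → PotAncX M X x x' Y y y'
  | step {Z : V} {z z' : RV Z} {Y : V} {y y' : RV Y} :
      PotAncX M X x x' Z z z' → M.PotParentEE Z z z' Y y y' → PotAncX M X x x' Y y y'

/-- `(x,x') ⤳_p (y,y')` for some directed path `p` between endogenous variables. -/
inductive PotAncE (M : CausalModel U V RU RV) (X : V) (x x' : RV X) :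
    ∀ Y : V, RV Y → RV Y → Prop
  | base {Y : V} {y y' : RV Y} : M.PotParentEE X x x' Y y y' → PotAncE M X x x' Y y y'
  | step {Z : V} {z z' : RV Z} {Y : V} {y y' : RV Y} :
      PotAncE M X x x' Z z z' → M.PotParentEE Z z z' Y y y' → PotAncE M X x x' Y y y'

/-- Direct sufficiency, Def. 3 (with possibly mixed exogenous/endogenous source
`(Se,xe) ∪ (Sv,xv)` and target `(Te,ye) ∪ (Tv,yv)`; in the basic case
`Se = Te = ∅`).  For every context agreeing with the exogenous part of the
source and every setting `z` of the endogenous variables outside the source and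
the target, the target values are guaranteed. -/
def DirectlySufficient (M : CausalModel U V RU RV)
    (Se : Set U) (xe : ∀ u, RU u) (Sv : Set V) (xv : ∀ v, RV v)
    (Te : Set U) (ye : ∀ u, RU u) (Tv : Set V) (yv : ∀ v, RV v) : Prop :=
  ∀ ctx : ∀ u, RU u, (∀ u ∈ Se, ctx u = xe u) →
    (∀ u ∈ Te, ctx u = ye u) ∧
    ∀ z : ∀ v, RV v,
      (M.intervene (Sv ∪ (Sv ∪ Tv)ᶜ) (Sv.piecewise xv z)).Sat ctx
        fun a => ∀ v ∈ Tv, a v = yv v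

/-- `(xv on Sv)` is weakly sufficient for `(yv on Tv)` w.r.t. `(M, ctx)`:
`(M,ctx) ⊨ [Sv ← xv] Tv = yv`. -/
def WeaklySufficient (M : CausalModel U V RU RV) (ctx : ∀ u, RU u)
    (Sv : Set V) (xv : ∀ v, RV v) (Tv : Set V) (yv : ∀ v, RV v) : Prop :=
  (M.intervene Sv xv).Sat ctx fun a => ∀ v ∈ Tv, a v = yv v

/-- Sufficiency, Def. 8: the chaining (transitive closure) of direct sufficiency,
starting from a source that may contain exogenous values `(Se,xe)`. -/
inductive Sufficient (M : CausalModel U V RU RV)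
    (Se : Set U) (xe : ∀ u, RU u) (Sv : Set V) (xv : ∀ v, RV v) :
    Set V → (∀ v, RV v) → Prop
  | base (Tv : Set V) (yv : ∀ v, RV v) :
      M.DirectlySufficient Se xe Sv xv ∅ xe Tv yv → Sufficient M Se xe Sv xv Tv yv
  | step (Tv : Set V) (yv : ∀ v, RV v) (Tv' : Set V) (yv' : ∀ v, RV v) :
      Sufficient M Se xe Sv xv Tv yv →
      M.DirectlySufficient ∅ xe Tv yv ∅ xe Tv' yv' →
      Sufficient M Se xe Sv xv Tv' yv'

/-- `(x⃗,x⃗') ⤳ (y⃗,y⃗')` via the explicit witness `(Ze,ze) ∪ (Zv,zv)`: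
the source and target are distinct sets of variables, the contrast values
differ on the respective domains, `(z⃗,x⃗)` is directly sufficient for `y⃗`,
`(z⃗,x⃗')` is directly sufficient for `y⃗'`, and the source is minimal. -/
def JointParentVia (M : CausalModel U V RU RV)
    (Se : Set U) (xe xe' : ∀ u, RU u) (Sv : Set V) (xv xv' : ∀ v, RV v)
    (Te : Set U) (ye ye' : ∀ u, RU u) (Tv : Set V) (yv yv' : ∀ v, RV v)
    (Ze : Set U) (ze : ∀ u, RU u) (Zv : Set V) (zv : ∀ v, RV v) : Prop :=
  (¬(Se = Te ∧ Sv = Tv)) ∧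
  (∀ u ∈ Se, xe u ≠ xe' u) ∧ (∀ v ∈ Sv, xv v ≠ xv' v) ∧
  (∀ u ∈ Te, ye u ≠ ye' u) ∧ (∀ v ∈ Tv, yv v ≠ yv' v) ∧
  Disjoint Ze Se ∧ Disjoint Zv Sv ∧
  M.DirectlySufficient (Ze ∪ Se) (Se.piecewise xe ze) (Zv ∪ Sv) (Sv.piecewise xv zv)
    Te ye Tv yv ∧
  M.DirectlySufficient (Ze ∪ Se) (Se.piecewise xe' ze) (Zv ∪ Sv) (Sv.piecewise xv' zv)
    Te ye' Tv yv' ∧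
  ∀ (Se' : Set U) (Sv' : Set V), Se' ⊆ Se → Sv' ⊆ Sv → ¬(Se' = Se ∧ Sv' = Sv) →
    ¬(M.DirectlySufficient (Ze ∪ Se') (Se'.piecewise xe ze) (Zv ∪ Sv')
        (Sv'.piecewise xv zv) Te ye Tv yv ∧
      M.DirectlySufficient (Ze ∪ Se') (Se'.piecewise xe' ze) (Zv ∪ Sv')
        (Sv'.piecewise xv' zv) Te ye' Tv yv')

/-- Potential joint parenthood, Def. 4: `(x⃗,x⃗') ⤳ (y⃗,y⃗')` for some witness. -/
def PotJointParent (M : CausalModel U V RU RV)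
    (Se : Set U) (xe xe' : ∀ u, RU u) (Sv : Set V) (xv xv' : ∀ v, RV v)
    (Te : Set U) (ye ye' : ∀ u, RU u) (Tv : Set V) (yv yv' : ∀ v, RV v) : Prop :=
  ∃ (Ze : Set U) (ze : ∀ u, RU u) (Zv : Set V) (zv : ∀ v, RV v),
    M.JointParentVia Se xe xe' Sv xv xv' Te ye ye' Tv yv yv' Ze ze Zv zv

/-- Actual joint parenthood w.r.t. `(M,u)`: potential joint parenthood by a
witness whose exogenous part is contained in `u` and whose endogenous part
(as well as the source) takes its actual value in `(M,u)`. -/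
def ActJointParent (M : CausalModel U V RU RV) (u : ∀ u, RU u)
    (Se : Set U) (xe xe' : ∀ u, RU u) (Sv : Set V) (xv xv' : ∀ v, RV v)
    (Te : Set U) (ye ye' : ∀ u, RU u) (Tv : Set V) (yv yv' : ∀ v, RV v) : Prop :=
  ∃ (Ze : Set U) (ze : ∀ u, RU u) (Zv : Set V) (zv : ∀ v, RV v),
    M.JointParentVia Se xe xe' Sv xv xv' Te ye ye' Tv yv yv' Ze ze Zv zv ∧
    (∀ w ∈ Ze, ze w = u w) ∧ (∀ w ∈ Se, xe w = u w) ∧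
    M.Sat u fun a => (∀ v ∈ Zv, a v = zv v) ∧ (∀ v ∈ Sv, a v = xv v)

/-- Potential joint ancestry, Def. 5: `(x⃗,x⃗') ⤳_n (y⃗,y⃗')` for some network `n`,
i.e. the transitive closure of potential joint parenthood. -/
inductive PotJointAnc (M : CausalModel U V RU RV)
    (Se : Set U) (xe xe' : ∀ u, RU u) (Sv : Set V) (xv xv' : ∀ v, RV v) :
    ∀ (Te : Set U) (ye ye' : ∀ u, RU u) (Tv : Set V) (yv yv' : ∀ v, RV v), Prop
  | base {Te : Set U} {ye ye' : ∀ u, RU u} {Tv : Set V} {yv yv' : ∀ v, RV v} :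
      M.PotJointParent Se xe xe' Sv xv xv' Te ye ye' Tv yv yv' →
      PotJointAnc M Se xe xe' Sv xv xv' Te ye ye' Tv yv yv'
  | step {Te : Set U} {ye ye' : ∀ u, RU u} {Tv : Set V} {yv yv' : ∀ v, RV v}
      {Te' : Set U} {ye2 ye2' : ∀ u, RU u} {Tv' : Set V} {yv2 yv2' : ∀ v, RV v} :
      PotJointAnc M Se xe xe' Sv xv xv' Te ye ye' Tv yv yv' →
      M.PotJointParent Te ye ye' Tv yv yv' Te' ye2 ye2' Tv' yv2 yv2' →
      PotJointAnc M Se xe xe' Sv xv xv' Te' ye2 ye2' Tv' yv2 yv2'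

/-- Actual joint ancestry w.r.t. `(M,u)`, Def. 7. -/
inductive ActJointAnc (M : CausalModel U V RU RV) (u : ∀ u, RU u)
    (Se : Set U) (xe xe' : ∀ u, RU u) (Sv : Set V) (xv xv' : ∀ v, RV v) :
    ∀ (Te : Set U) (ye ye' : ∀ u, RU u) (Tv : Set V) (yv yv' : ∀ v, RV v), Prop
  | base {Te : Set U} {ye ye' : ∀ u, RU u} {Tv : Set V} {yv yv' : ∀ v, RV v} :
      M.ActJointParent u Se xe xe' Sv xv xv' Te ye ye' Tv yv yv' →
      ActJointAnc M u Se xe xe' Sv xv xv' Te ye ye' Tv yv yv'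
  | step {Te : Set U} {ye ye' : ∀ u, RU u} {Tv : Set V} {yv yv' : ∀ v, RV v}
      {Te' : Set U} {ye2 ye2' : ∀ u, RU u} {Tv' : Set V} {yv2 yv2' : ∀ v, RV v} :
      ActJointAnc M u Se xe xe' Sv xv xv' Te ye ye' Tv yv yv' →
      M.ActJointParent u Te ye ye' Tv yv yv' Te' ye2 ye2' Tv' yv2 yv2' →
      ActJointAnc M u Se xe xe' Sv xv xv' Te' ye2 ye2' Tv' yv2 yv2'

/-- Combine a family of values on `A` with a family of values on `B` into a
family of values on `A ⊕ B`. -/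
def extFn {A B : Type} {RA : A → Type} {RB : B → Type}
    (f : ∀ a, RA a) (g : ∀ b, RB b) : ∀ x : A ⊕ B, Sum.elim RA RB x
  | Sum.inl a => f a
  | Sum.inr b => g b

end CausalModel

open CausalModel

/-! STATEMENT 11 (Example 1): the model `M'` with one exogenous binary variable
`C` (represented by `Unit`), endogenous binary variables `A`, `B` with
equations `A = C`, `B = C`, and endogenous variable `E` with range `{0,1,2}`
(represented by `Fin 3`) and equation `E = A + B`. -/

inductive EVar1 | A | B | E
deriving DecidableEq

/-- Ranges of the endogenous variables of Example 1. -/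
def RV1 : EVar1 → Type
  | .A => Bool
  | .B => Bool
  | .E => Fin 3

/-- The model `M'` of Example 1: `A = C`, `B = C`, `E = A + B`. -/
def Ex1 : CausalModel Unit EVar1 (fun _ => Bool) RV1 where
  F X ctx a :=
    match X with
    | .A => ctx ()
    | .B => ctx ()
    | .E => ((bif (a .A : Bool) then 1 else 0) + (bif (a .B : Bool) then 1 else 0) : Fin 3)
  selfIndep := by
    intro X ctx a a' h
    cases X with
    | A => rfl
    | B => rfl
    | E =>
      have hA := h .A (by rintro ⟨⟩)
      have hB := h .B (by rintro ⟨⟩)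
      show (bif (a .A : Bool) then (1 : Fin 3) else 0) + (bif (a .B : Bool) then 1 else 0)
         = (bif (a' .A : Bool) then (1 : Fin 3) else 0) + (bif (a' .B : Bool) then 1 else 0)
      rw [hA, hB]

/-- Values `A = 1, B = 1` (and a dummy value for `E`). -/
def vTT : ∀ v, RV1 v
  | .A => true
  | .B => true
  | .E => (0 : Fin 3)

/-- Values `A = 0, B = 0` (and a dummy value for `E`). -/
def vFF : ∀ v, RV1 v
  | .A => false
  | .B => false
  | .E => (0 : Fin 3)

/-- Values with `E = 2` (dummy values for `A`, `B`). -/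
def vE2 : ∀ v, RV1 v
  | .A => false
  | .B => false
  | .E => (2 : Fin 3)

/-- Values with `E = 0` (dummy values for `A`, `B`). -/
def vE0 : ∀ v, RV1 v
  | .A => false
  | .B => false
  | .E => (0 : Fin 3)

/-- Direct sufficiency in terms of the solutions of the intervened model: every setting that
agrees with the source and satisfies the equations of the remaining target variables takes the
target values. -/
theorem CausalModel.directlySufficient_iff {U V : Type} {RU : U → Type} {RV : V → Type}
    (M : CausalModel U V RU RV) (Se : Set U) (xe : ∀ u, RU u) (Sv : Set V) (xv : ∀ v, RV v)
    (Te : Set U) (ye : ∀ u, RU u) (Tv : Set V) (yv : ∀ v, RV v) :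
    M.DirectlySufficient Se xe Sv xv Te ye Tv yv ↔
      ∀ ctx : ∀ u, RU u, (∀ u ∈ Se, ctx u = xe u) →
        (∀ u ∈ Te, ctx u = ye u) ∧
        ∀ a : ∀ v, RV v, (∀ v ∈ Sv, a v = xv v) →
          (∀ v ∈ Tv, v ∉ Sv → a v = M.F v ctx a) → ∀ v ∈ Tv, a v = yv v := by
  refine forall₂_congr fun ctx _ => and_congr_right fun _ => ⟨?_, ?_⟩
  · intro h a hS hT
    refine h a a fun X => ?_
    by_cases hX : X ∈ Sv
    · simp [intervene, hX, hS X hX]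
    · by_cases hX' : X ∈ Tv
      · simpa [intervene, hX, hX'] using hT X hX' hX
      · simp [intervene, hX, hX']
  · intro h z a ha
    refine h a (fun v hv => ?_) fun v hv hv' => ?_
    · simpa [intervene, hv] using ha v
    · simpa [intervene, hv, hv'] using ha v

/-- The setting of the endogenous variables of `Ex1` with the given values. -/
def EVar1.setting (x y : Bool) (e : Fin 3) : ∀ v, RV1 v
  | .A => x
  | .B => y
  | .E => e

theorem Ex1_F_A (ctx : Unit → Bool) (a : ∀ v, RV1 v) : Ex1.F .A ctx a = ctx () := rfl

theorem Ex1_F_B (ctx : Unit → Bool) (a : ∀ v, RV1 v) : Ex1.F .B ctx a = ctx () := rfl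

theorem Ex1_F_E (ctx : Unit → Bool) (a : ∀ v, RV1 v) :
    Ex1.F .E ctx a =
      ((bif (a .A : Bool) then 1 else 0) + (bif (a .B : Bool) then 1 else 0) : Fin 3) := rfl

theorem Ex1_F_E_update_A {inst : DecidableEq EVar1} (ctx : Unit → Bool) (a : ∀ v, RV1 v) (x : RV1 .A) :
    Ex1.F .E ctx (Function.update a .A x) =
      ((bif (x : Bool) then 1 else 0) + (bif (a .B : Bool) then 1 else 0) : Fin 3) := by
  have hA : Function.update a .A x .A = x := Function.update_self ..
  have hB : Function.update a .A x .B = a .B := Function.update_of_ne EVar1.noConfusion ..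
  rw [Ex1_F_E, hA, hB]

theorem Ex1_F_E_update_B {inst : DecidableEq EVar1} (ctx : Unit → Bool) (a : ∀ v, RV1 v) (x : RV1 .B) :
    Ex1.F .E ctx (Function.update a .B x) =
      ((bif (a .A : Bool) then 1 else 0) + (bif (x : Bool) then 1 else 0) : Fin 3) := by
  have hA : Function.update a .B x .A = a .A := Function.update_of_ne EVar1.noConfusion ..
  have hB : Function.update a .B x .B = x := Function.update_self ..
  rw [Ex1_F_E, hA, hB]

theorem Ex1_ancestorX : Ex1.AncestorX () EVar1.E := by
  refine ⟨.A, ⟨fun _ => true, vTT, true, false, ?_⟩, Or.inr (.single ⟨nofun, fun _ => true, vFF,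
    true, false, ?_⟩)⟩
  · rw [Ex1_F_A, Ex1_F_A]
    simp [RV1]
  · exact fun h => absurd ((Ex1_F_E_update_A ..).symm.trans (h.trans (Ex1_F_E_update_A ..)))
      (show ¬ (1 + 0 : Fin 3) = 0 + 0 by decide)

theorem Ex1_not_potAncX :
    ¬ Ex1.PotAncX () true false EVar1.E (2 : Fin 3) (0 : Fin 3) := by
  have key : ∀ x x' y : Bool,
      ((bif x then 1 else 0) + (bif y then 1 else 0) : Fin 3) = 2 →
      ((bif x' then 1 else 0) + (bif y then 1 else 0) : Fin 3) ≠ 0 := by decide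
  have key' : ∀ x x' y : Bool,
      ((bif y then 1 else 0) + (bif x then 1 else 0) : Fin 3) = 2 →
      ((bif y then 1 else 0) + (bif x' then 1 else 0) : Fin 3) ≠ 0 := by decide
  suffices ∀ (Y : EVar1) (y y' : RV1 Y), Ex1.PotAncX () true false Y y y' →
      Y = .E → HEq y (2 : Fin 3) → HEq y' (0 : Fin 3) → False from
    fun h => this .E _ _ h rfl .rfl .rfl
  intro Y y y' h hY hy hy'
  cases h with
  | base h =>
    subst hY
    obtain rfl := eq_of_heq hy
    obtain rfl := eq_of_heq hy'
    obtain ⟨-, hne, ctx, z, h₁, h₂⟩ := h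
    exact hne (h₁.symm.trans h₂)
  | @step Z z z' _ _ _ _ h =>
    subst hY
    obtain rfl := eq_of_heq hy
    obtain rfl := eq_of_heq hy'
    obtain ⟨hZ, -, -, ctx, w, h₁, h₂⟩ := h
    cases Z with
    | A =>
      exact key z z' (w .B) ((Ex1_F_E_update_A ..).symm.trans h₁)
        ((Ex1_F_E_update_A ..).symm.trans h₂)
    | B =>
      exact key' z z' (w .A) ((Ex1_F_E_update_B ..).symm.trans h₁)
        ((Ex1_F_E_update_B ..).symm.trans h₂)
    | E => exact hZ rfl

theorem Ex1_potJointParent_AB (xv xv' : ∀ v, RV1 v) :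
    Ex1.PotJointParent {()} (fun _ => true) (fun _ => false) ∅ xv xv'
      ∅ (fun _ => true) (fun _ => true) {EVar1.A, EVar1.B} vTT vFF := by
  refine ⟨∅, fun _ => true, ∅, vTT, by simp, by simp, by simp, by simp, ?_, by simp, by simp,
    ?_, ?_, ?_⟩
  · rintro v (rfl | rfl) <;> exact Bool.noConfusion
  · rw [directlySufficient_iff]
    intro ctx hc
    have hc : ctx () = true := by simpa using hc ()
    refine ⟨by simp, fun a _ h v hv => ?_⟩
    have := h v hv (by simp)
    rcases hv with rfl | rfl <;> exact this.trans hc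
  · rw [directlySufficient_iff]
    intro ctx hc
    have hc : ctx () = false := by simpa using hc ()
    refine ⟨by simp, fun a _ h v hv => ?_⟩
    have := h v hv (by simp)
    rcases hv with rfl | rfl <;> exact this.trans hc
  · rintro Se' Sv' hSe hSv hne ⟨h, -⟩
    obtain rfl : Sv' = ∅ := Set.subset_empty_iff.1 hSv
    obtain rfl | rfl := Set.subset_singleton_iff_eq.1 hSe
    · rw [directlySufficient_iff] at h
      have := (h (fun _ => false) (by simp)).2 vFF (by simp)
        (by rintro v (rfl | rfl) - <;> rfl) .A (by simp)
      exact Bool.false_ne_true this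
    · exact hne ⟨rfl, rfl⟩

theorem Ex1_potJointParent_E :
    Ex1.PotJointParent ∅ (fun _ => true) (fun _ => true) {EVar1.A, EVar1.B} vTT vFF
      ∅ (fun _ => true) (fun _ => true) {EVar1.E} vE2 vE0 := by
  refine ⟨∅, fun _ => true, ∅, vTT, ?_, by simp, ?_, by simp, ?_, by simp, by simp,
    ?_, ?_, ?_⟩
  · rintro ⟨-, h⟩
    have : EVar1.A ∈ ({EVar1.E} : Set EVar1) := h ▸ Set.mem_insert _ _
    simp at this
  · rintro v (rfl | rfl) <;> exact Bool.noConfusion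
  · rintro v rfl
    change ¬ (2 : Fin 3) = 0
    decide
  · rw [directlySufficient_iff]
    refine fun ctx _ => ⟨by simp, ?_⟩
    rintro a hS hT v rfl
    have hA := hS .A (by simp)
    have hB := hS .B (by simp)
    rw [hT .E rfl (by simp), Ex1_F_E, hA, hB]
    simp [vTT, vE2]
    rfl
  · rw [directlySufficient_iff]
    refine fun ctx _ => ⟨by simp, ?_⟩
    rintro a hS hT v rfl
    have hA := hS .A (by simp)
    have hB := hS .B (by simp)
    rw [hT .E rfl (by simp), Ex1_F_E, hA, hB]
    simp [vFF, vE0]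
    rfl
  · rintro Se' Sv' hSe hSv hne ⟨h, -⟩
    rw [directlySufficient_iff] at h
    obtain rfl : Se' = ∅ := Set.subset_empty_iff.1 hSe
    have hSE : EVar1.E ∉ Sv' := fun hE => by simpa using hSv hE
    by_cases hA : EVar1.A ∈ Sv'
    · have hB : EVar1.B ∉ Sv' := fun hB =>
        hne ⟨rfl, hSv.antisymm (by rintro v (rfl | rfl) <;> assumption)⟩
      have := (h (fun _ => true) (by simp)).2 (EVar1.setting true false 1)
        (fun v hv => by
          rw [Set.empty_union] at hv
          rw [Set.piecewise_eq_of_mem _ _ _ hv]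
          cases v with
          | A => rfl
          | B => exact absurd hv hB
          | E => exact absurd hv hSE)
        (by rintro v rfl -; rfl) .E rfl
      exact absurd this (show ¬ (1 : Fin 3) = 2 by decide)
    · have := (h (fun _ => true) (by simp)).2 (EVar1.setting false true 1)
        (fun v hv => by
          rw [Set.empty_union] at hv
          rw [Set.piecewise_eq_of_mem _ _ _ hv]
          cases v with
          | A => exact absurd hv hA
          | B => rfl
          | E => exact absurd hv hSE)
        (by rintro v rfl -; rfl) .E rfl
      exact absurd this (show ¬ (1 : Fin 3) = 2 by decide)

/-- Example 1 verification:
(i) `C` is an ancestor of `E` in `M'`;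
(ii) there is no directed path `p` in `M'` with `(1_C,0_C) ⤳_p (2_E,0_E)`,
i.e. no chain of single-variable potential-parenthood steps links `C`'s values
`1, 0` to `E`'s values `2, 0`;
(iii) `(1_C,0_C)` are potential joint ancestors of `(2_E,0_E)` in `M'`, via
`(1_C,0_C) ⤳ (1_A,1_B; 0_A,0_B) ⤳ (2_E,0_E)`. -/
theorem example1_verification :
    -- (i)
    Ex1.AncestorX () EVar1.E ∧
    -- (ii)
    ¬ Ex1.PotAncX () true false EVar1.E (2 : Fin 3) (0 : Fin 3) ∧
    -- (iii), including the two joint-parenthood steps of the network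
    Ex1.PotJointParent {()} (fun _ => true) (fun _ => false) ∅ vTT vFF
      ∅ (fun _ => true) (fun _ => true) {EVar1.A, EVar1.B} vTT vFF ∧
    Ex1.PotJointParent ∅ (fun _ => true) (fun _ => true) {EVar1.A, EVar1.B} vTT vFF
      ∅ (fun _ => true) (fun _ => true) {EVar1.E} vE2 vE0 ∧
    Ex1.PotJointAnc {()} (fun _ => true) (fun _ => false) ∅ vTT vTT
      ∅ (fun _ => true) (fun _ => true) {EVar1.E} vE2 vE0 := by
  exact ⟨Ex1_ancestorX, Ex1_not_potAncX, Ex1_potJointParent_AB vTT vFF, Ex1_potJointParent_E,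
    .step (.base (Ex1_potJointParent_AB vTT vTT)) Ex1_potJointParent_E⟩
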